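/- Let n, p ≥ 1, B⁺ = {b ∈ ℝ^p : b₁ ≥ … ≥ b_p ≥ 1}, and λ ∈ ℝ^p with λ ≺ 0. Let φ : B⁺ → ℝ be measurable such that φ(b) · ∏_{i=1}^{p} b_i^{-(n-1)} is weakly bounded by ∏_{i=1}^{p} b_i^{λ_i}. Let η_{k,i} ∈ [0,1] (1 ≤ k ≤ n, 1 ≤ i ≤ p) satisfy the non-strict inequalities ∑_{i=1}^{j} (λ_i + ∑_{k=1}^{n} η_{k,i}) ≤ 0 for every j ∈ {1,…,p}, and set μ_k = ∑_{i=1}^{p} η_{k,i}. Then for every a ∈ [1,∞)^n the integral L(a,φ) = ∫_{B⁺} ( ∏_{i=1}^{p} ∏_{k=1}^{n} (a_k² + b_i²)^{-1/2} ) φ(b) db converges absolutely, and L(a,φ) is weakly bounded by ∏_{k=1}^{n} a_k^{-μ_k}: for every δ ∈ (0,1) there is C > 0 with |L(a,φ)| ≤ C ∏_{k=1}^{n} a_k^{-μ_k(1-δ)} for all a ∈ [1,∞)^n. -/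

import Mathlib

open MeasureTheory Set Finset

/-- The region `B⁺ = {b ∈ ℝ^p : b₁ ≥ b₂ ≥ … ≥ b_p ≥ 1}`. -/
def Bplus (p : ℕ) : Set (Fin p → ℝ) :=
  {b | (∀ i, 1 ≤ b i) ∧ ∀ i j : Fin p, i ≤ j → b j ≤ b i}

/-- Abel summation: pairing a sequence with nonpositive partial sums against a nonnegative
antitone sequence gives a nonpositive number. -/
lemma sum_mul_nonpos_of_antitone {p : ℕ} {x y : Fin p → ℝ} (hy : ∀ i, 0 ≤ y i)
    (hanti : ∀ i j : Fin p, i ≤ j → y j ≤ y i)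
    (hx : ∀ j : Fin p, ∑ i ∈ Finset.Iic j, x i ≤ 0) : ∑ i, x i * y i ≤ 0 := by
  have hx' : ∀ j : Fin p, (∑ i, if i ≤ j then x i else 0) ≤ 0 := fun j => by
    rw [← Finset.sum_filter]
    convert hx j using 2
    ext i
    simp
  clear hx
  induction p with
  | zero => simp
  | succ p ih =>
    have hinit := ih (x := fun i => x i.castSucc)
      (y := fun i => y i.castSucc - y (Fin.last p))
      (fun i => sub_nonneg.2 (hanti _ _ (Fin.le_last _)))
      (fun i j hij => sub_le_sub_right (hanti _ _ (Fin.castSucc_le_castSucc_iff.2 hij)) _)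
      (fun j => by
        have h := hx' j.castSucc
        rw [Fin.sum_univ_castSucc] at h
        simpa [(Fin.castSucc_lt_last j).not_ge] using h)
    have hlast : (∑ i, x i) ≤ 0 := by
      simpa [Fin.le_last] using hx' (Fin.last p)
    have hmul := mul_nonpos_of_nonpos_of_nonneg hlast (hy (Fin.last p))
    rw [Fin.sum_univ_castSucc] at hmul ⊢
    simp only [mul_sub, Finset.sum_sub_distrib, ← Finset.sum_mul] at hinit
    linarith

lemma prod_rpow_le_prod_rpow_of_mem_Bplus {p : ℕ} {x y b : Fin p → ℝ} (hb : b ∈ Bplus p)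
    (h : ∀ j : Fin p, ∑ i ∈ Finset.Iic j, (x i - y i) ≤ 0) :
    ∏ i, b i ^ x i ≤ ∏ i, b i ^ y i := by
  have hpos : ∀ i, 0 < b i := fun i => zero_lt_one.trans_le (hb.1 i)
  have hexp : ∀ z : Fin p → ℝ, ∏ i, b i ^ z i = Real.exp (∑ i, z i * Real.log (b i)) := by
    intro z
    rw [Real.exp_sum]
    exact Finset.prod_congr rfl fun i _ => by rw [Real.rpow_def_of_pos (hpos i), mul_comm]
  rw [hexp, hexp, Real.exp_le_exp, ← sub_nonpos, ← Finset.sum_sub_distrib]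
  simp only [← sub_mul]
  exact sum_mul_nonpos_of_antitone (fun i => Real.log_nonneg (hb.1 i))
    (fun i j hij => Real.log_le_log (hpos j) (hb.2 i j hij)) h

lemma measurableSet_Bplus (p : ℕ) : MeasurableSet (Bplus p) := by
  have : Bplus p = (⋂ i, {b | 1 ≤ b i}) ∩ ⋂ i, ⋂ j, ⋂ (_ : i ≤ j), {b | b j ≤ b i} := by
    ext b
    simp [Bplus]
  rw [this]
  exact (MeasurableSet.iInter fun i => measurableSet_le measurable_const (measurable_pi_apply i)).inter
    (MeasurableSet.iInter fun i => MeasurableSet.iInter fun j => MeasurableSet.iInter fun _ =>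
      measurableSet_le (measurable_pi_apply j) (measurable_pi_apply i))

/-- `∏ i, b i ^ (ν i - 1)` is integrable on `Bplus p` when all partial sums of `ν` are negative. -/
lemma integrableOn_Bplus_prod_rpow {p : ℕ} {ν : Fin p → ℝ}
    (hν : ∀ j : Fin p, ∑ i ∈ Finset.Iic j, ν i < 0) :
    IntegrableOn (fun b : Fin p → ℝ => ∏ i, b i ^ (ν i - 1)) (Bplus p) := by
  obtain ⟨c, hc, hcpos⟩ : ∃ c : ℝ, (∀ j : Fin p, ∑ i ∈ Finset.Iic j, (ν i + c) < 0) ∧ 0 < c := by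
    have hev : ∀ᶠ c : ℝ in nhdsWithin 0 (Set.Ioi 0),
        ∀ j : Fin p, ∑ i ∈ Finset.Iic j, (ν i + c) < 0 := by
      refine Filter.eventually_all.2 fun j => ?_
      have hcont : Continuous fun c : ℝ => ∑ i ∈ Finset.Iic j, (ν i + c) := by fun_prop
      exact (hcont.tendsto 0).eventually_lt_const (by simpa using hν j) |>.filter_mono
        nhdsWithin_le_nhds
    exact (hev.and self_mem_nhdsWithin).exists
  have hone : Integrable ((Set.Ici (1 : ℝ)).indicator fun t => t ^ (-c - 1)) := by
    rw [integrable_indicator_iff measurableSet_Ici, integrableOn_Ici_iff_integrableOn_Ioi]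
    exact integrableOn_Ioi_rpow_of_lt (by linarith) one_pos
  have hprod : Integrable fun b : Fin p → ℝ =>
      ∏ i, (Set.Ici (1 : ℝ)).indicator (fun t => t ^ (-c - 1)) (b i) :=
    Integrable.fintype_prod (f := fun _ => (Set.Ici (1 : ℝ)).indicator fun t => t ^ (-c - 1))
      fun _ => hone
  refine hprod.integrableOn.mono' (Measurable.aestronglyMeasurable (by fun_prop)) ?_
  filter_upwards [ae_restrict_mem (measurableSet_Bplus p)] with b hb
  rw [Real.norm_of_nonneg
    (Finset.prod_nonneg fun i _ => Real.rpow_nonneg (zero_le_one.trans (hb.1 i)) _)]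
  refine (prod_rpow_le_prod_rpow_of_mem_Bplus (y := fun _ => -c - 1) hb fun j => ?_).trans_eq ?_
  · exact (Finset.sum_congr rfl fun i _ => by ring).trans_le (hc j).le
  · exact Finset.prod_congr rfl fun i _ =>
      (Set.indicator_of_mem (Set.mem_Ici.2 (hb.1 i)) fun t : ℝ => t ^ (-c - 1)).symm

lemma rpow_neg_half_sq_add_sq_le {a b θ : ℝ} (ha : 0 < a) (hb : 0 < b)
    (hθ : θ ∈ Set.Icc (0 : ℝ) 1) :
    (a ^ 2 + b ^ 2) ^ (-(1 : ℝ) / 2) ≤ a ^ (-θ) * b ^ (θ - 1) := by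
  have hpos : 0 < a ^ 2 + b ^ 2 := by positivity
  have heq : (a ^ 2 + b ^ 2) ^ (-(1 : ℝ) / 2) =
      Real.sqrt (a ^ 2 + b ^ 2) ^ (-θ) * Real.sqrt (a ^ 2 + b ^ 2) ^ (θ - 1) := by
    rw [← Real.rpow_add (Real.sqrt_pos.2 hpos), Real.sqrt_eq_rpow, ← Real.rpow_mul hpos.le]
    congr 1
    ring
  rw [heq]
  exact mul_le_mul
    (Real.rpow_le_rpow_of_nonpos ha (Real.le_sqrt_of_sq_le (by nlinarith)) (by linarith [hθ.1]))
    (Real.rpow_le_rpow_of_nonpos hb (Real.le_sqrt_of_sq_le (by nlinarith)) (by linarith [hθ.2]))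
    (by positivity) (by positivity)

lemma prod_kernel_le {n p : ℕ} {a : Fin n → ℝ} {b : Fin p → ℝ} {θ : Fin n → Fin p → ℝ}
    (ha : ∀ k, 0 < a k) (hb : ∀ i, 0 < b i) (hθ : ∀ k i, θ k i ∈ Set.Icc (0 : ℝ) 1) :
    ∏ i, ∏ k, (a k ^ 2 + b i ^ 2) ^ (-(1 : ℝ) / 2) ≤
      (∏ k, a k ^ (-∑ i, θ k i)) * ∏ i, b i ^ ((∑ k, θ k i) - n) := by
  calc ∏ i, ∏ k, (a k ^ 2 + b i ^ 2) ^ (-(1 : ℝ) / 2)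
      ≤ ∏ i, ∏ k, a k ^ (-θ k i) * b i ^ (θ k i - 1) :=
        Finset.prod_le_prod (fun i _ => Finset.prod_nonneg fun k _ => by positivity) fun i _ =>
          Finset.prod_le_prod (fun k _ => by positivity) fun k _ =>
            rpow_neg_half_sq_add_sq_le (ha k) (hb i) (hθ k i)
    _ = _ := by
        simp only [Finset.prod_mul_distrib]
        rw [Finset.prod_comm]
        congr 1
        · refine Finset.prod_congr rfl fun k _ => ?_
          rw [← Real.rpow_sum_of_pos (ha k), Finset.sum_neg_distrib]
        · refine Finset.prod_congr rfl fun i _ => ?_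
          rw [← Real.rpow_sum_of_pos (hb i), Finset.sum_sub_distrib]
          simp

/-- Let `n, p ≥ 1`, `λ ≺ 0`, and `φ : B⁺ → ℝ` measurable such that
`φ(b) ∏ᵢ bᵢ^{-(n-1)}` is weakly bounded by `∏ᵢ bᵢ^{λᵢ}`. Let `η_{k,i} ∈ [0,1]`
satisfy `∑_{i≤j} (λᵢ + ∑ₖ η_{k,i}) ≤ 0` for every `j`, and `μₖ = ∑ᵢ η_{k,i}`.
Then for every `a ∈ [1,∞)^n` the integral
`L(a,φ) = ∫_{B⁺} (∏ᵢ∏ₖ (aₖ²+bᵢ²)^{-1/2}) φ(b) db` converges absolutely, and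
`L(a,φ)` is weakly bounded by `∏ₖ aₖ^{-μₖ}`: for every `δ ∈ (0,1)` there is
`C > 0` with `|L(a,φ)| ≤ C ∏ₖ aₖ^{-μₖ(1-δ)}` for all `a ∈ [1,∞)^n`. -/
theorem stmt_11 (n p : ℕ) (hn : 1 ≤ n) (hp : 1 ≤ p) (lam : Fin p → ℝ)
    (hlam : ∀ j : Fin p, ∑ i ∈ Finset.Iic j, lam i < 0)
    (φ : (Fin p → ℝ) → ℝ) (hφmeas : Measurable φ)
    (hwb : ∃ δ₀ > (0 : ℝ), ∀ δ : ℝ, 0 < δ → δ < δ₀ →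
      ∃ C > (0 : ℝ), ∀ b ∈ Bplus p,
        |φ b * ∏ i, b i ^ (-((n : ℝ) - 1))| ≤ C * ∏ i, b i ^ (lam i * (1 - δ)))
    (η : Fin n → Fin p → ℝ) (hη : ∀ k i, η k i ∈ Set.Icc (0 : ℝ) 1)
    (hηlam : ∀ j : Fin p, ∑ i ∈ Finset.Iic j, (lam i + ∑ k, η k i) ≤ 0) :
    (∀ a : Fin n → ℝ, (∀ k, 1 ≤ a k) →
      IntegrableOn
        (fun b : Fin p → ℝ =>
          (∏ i, ∏ k, (a k ^ 2 + b i ^ 2) ^ (-(1 : ℝ) / 2)) * φ b)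
        (Bplus p)) ∧
    (∀ δ : ℝ, 0 < δ → δ < 1 → ∃ C > (0 : ℝ), ∀ a : Fin n → ℝ, (∀ k, 1 ≤ a k) →
      |∫ b in Bplus p,
          (∏ i, ∏ k, (a k ^ 2 + b i ^ 2) ^ (-(1 : ℝ) / 2)) * φ b| ≤
        C * ∏ k, a k ^ (-((∑ i, η k i) * (1 - δ)))) := by
  obtain ⟨δ₀, hδ₀, hwb⟩ := hwb
  have key : ∀ δ : ℝ, 0 < δ → δ < 1 → ∃ (C : ℝ) (g : (Fin p → ℝ) → ℝ), 0 < C ∧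
      IntegrableOn g (Bplus p) ∧ (∀ b ∈ Bplus p, 0 ≤ g b) ∧
      ∀ a : Fin n → ℝ, (∀ k, 1 ≤ a k) → ∀ b ∈ Bplus p,
        ‖(∏ i, ∏ k, (a k ^ 2 + b i ^ 2) ^ (-(1 : ℝ) / 2)) * φ b‖ ≤
          C * (∏ k, a k ^ (-((∑ i, η k i) * (1 - δ)))) * g b := by
    intro δ hδ hδ1
    obtain ⟨ε, hε, hεmin⟩ := exists_between (lt_min hδ hδ₀)
    have hεδ : ε < δ := hεmin.trans_le (min_le_left _ _)
    obtain ⟨C, hC, hφ⟩ := hwb ε hε (hεmin.trans_le (min_le_right _ _))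
    let ν : Fin p → ℝ := fun i => lam i * (1 - ε) + (∑ k, η k i) * (1 - δ)
    have hν : ∀ j : Fin p, ∑ i ∈ Finset.Iic j, ν i < 0 := by
      intro j
      have h1 := hlam j
      have h2 := hηlam j
      simp only [ν, Finset.sum_add_distrib, ← Finset.sum_mul] at h2 ⊢
      nlinarith [mul_pos (sub_pos.2 hεδ) (neg_pos.2 h1),
        mul_nonneg (sub_pos.2 hδ1).le (neg_nonneg.2 h2)]
    refine ⟨C, fun b => ∏ i, b i ^ (ν i - 1), hC, integrableOn_Bplus_prod_rpow hν,
      fun b hb => Finset.prod_nonneg fun i _ => Real.rpow_nonneg (zero_le_one.trans (hb.1 i)) _,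
      fun a ha b hb => ?_⟩
    have hapos : ∀ k, 0 < a k := fun k => zero_lt_one.trans_le (ha k)
    have hbpos : ∀ i, 0 < b i := fun i => zero_lt_one.trans_le (hb.1 i)
    have hker := prod_kernel_le (θ := fun k i => η k i * (1 - δ)) hapos hbpos fun k i =>
      ⟨mul_nonneg (hη k i).1 (by linarith),
        mul_le_one₀ (hη k i).2 (by linarith) (by linarith)⟩
    have hknn : 0 ≤ ∏ i, ∏ k, (a k ^ 2 + b i ^ 2) ^ (-(1 : ℝ) / 2) := by positivity
    have hann : 0 ≤ ∏ k, a k ^ (-∑ i, η k i * (1 - δ)) :=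
      Finset.prod_nonneg fun k _ => Real.rpow_nonneg (hapos k).le _
    have hQ : 0 < ∏ i, b i ^ (-((n : ℝ) - 1)) :=
      Finset.prod_pos fun i _ => Real.rpow_pos_of_pos (hbpos i) _
    have hφb : |φ b| ≤ C * (∏ i, b i ^ (lam i * (1 - ε))) / ∏ i, b i ^ (-((n : ℝ) - 1)) := by
      rw [le_div_iff₀ hQ]
      simpa only [abs_mul, abs_of_pos hQ] using hφ b hb
    rw [norm_mul, Real.norm_of_nonneg hknn, Real.norm_eq_abs]
    refine (mul_le_mul hker hφb (abs_nonneg _) (mul_nonneg hann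
      (Finset.prod_nonneg fun i _ => Real.rpow_nonneg (hbpos i).le _))).trans_eq ?_
    have hcomb : (∏ i, b i ^ ((∑ k, η k i * (1 - δ)) - n)) *
        ((∏ i, b i ^ (lam i * (1 - ε))) / ∏ i, b i ^ (-((n : ℝ) - 1))) =
        ∏ i, b i ^ (ν i - 1) := by
      rw [← Finset.prod_div_distrib, ← Finset.prod_mul_distrib]
      refine Finset.prod_congr rfl fun i _ => ?_
      rw [← Real.rpow_sub (hbpos i), ← Real.rpow_add (hbpos i), ← Finset.sum_mul]
      congr 1
      simp only [ν]
      ring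
    simp only [← hcomb, ← Finset.sum_mul]
    ring
  have hint : ∀ a : Fin n → ℝ, (∀ k, 1 ≤ a k) →
      IntegrableOn (fun b : Fin p → ℝ =>
        (∏ i, ∏ k, (a k ^ 2 + b i ^ 2) ^ (-(1 : ℝ) / 2)) * φ b) (Bplus p) := by
    intro a ha
    obtain ⟨C, g, -, hg, -, hbound⟩ := key (1 / 2) (by norm_num) (by norm_num)
    refine (hg.const_mul (C * ∏ k, a k ^ (-((∑ i, η k i) * (1 - 1 / 2))))).mono'
      (Measurable.aestronglyMeasurable (by fun_prop)) ?_
    filter_upwards [ae_restrict_mem (measurableSet_Bplus p)] with b hb using hbound a ha b hb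
  refine ⟨hint, fun δ hδ hδ1 => ?_⟩
  obtain ⟨C, g, hC, hg, hg0, hbound⟩ := key δ hδ hδ1
  have hI : 0 ≤ ∫ b in Bplus p, g b := setIntegral_nonneg (measurableSet_Bplus p) hg0
  refine ⟨C * ((∫ b in Bplus p, g b) + 1), by positivity, fun a ha => ?_⟩
  have hA : 0 ≤ ∏ k, a k ^ (-((∑ i, η k i) * (1 - δ))) :=
    Finset.prod_nonneg fun k _ => Real.rpow_nonneg (zero_le_one.trans (ha k)) _
  have hle := norm_integral_le_of_norm_le
    (hg.const_mul (C * ∏ k, a k ^ (-((∑ i, η k i) * (1 - δ)))))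
    ((ae_restrict_mem (measurableSet_Bplus p)).mono fun b hb => hbound a ha b hb)
  rw [integral_const_mul, Real.norm_eq_abs] at hle
  refine hle.trans ?_
  nlinarith [mul_nonneg hC.le hA]
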